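/- Let J be an ideal of R = K[x_1,...,x_n] such that I = Rad J is a squarefree monomial ideal generated by at most n−1 squarefree monomials. Then ara J ≤ n − (n−1)/τ(I), where τ(I) is the maximal height of a minimal prime of I. -/

import Mathlib

open MvPolynomial

/-- The arithmetical rank of an ideal: the least number of elements generating it up to
radical. -/
noncomputable def ara {R : Type*} [CommRing R] (J : Ideal R) : ℕ :=
  sInf {s : ℕ | ∃ f : Fin s → R,
    Ideal.radical (Ideal.span (Set.range f)) = Ideal.radical J}

theorem ara_le {R : Type*} [CommRing R] {J : Ideal R} {s : ℕ} (f : Fin s → R)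
    (hf : Ideal.radical (Ideal.span (Set.range f)) = Ideal.radical J) : ara J ≤ s :=
  Nat.sInf_le ⟨f, hf⟩

/-- If one of the generators `g a` can only vanish together with at least `k` others, then the
ideal they generate is generated up to radical by `m - k` elements: `g a` and the elementary
symmetric functions of degree less than `m - k` in the other generators. -/
theorem ara_le_card_sub {R ι : Type*} [CommRing R] [DecidableEq ι] {M : Finset ι} {g : ι → R}
    {J : Ideal R} (hJ : J.radical = (Ideal.span (g '' M)).radical) {a : ι} (ha : a ∈ M) {k : ℕ}
    (hkM : k < M.card)
    (hk : ∀ p : Ideal R, p.IsPrime → g a ∈ p → ∃ N ⊆ M.erase a, k ≤ N.card ∧ ∀ b ∈ N, g b ∈ p) :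
    ara J ≤ M.card - k := by
  classical
  let q : ℕ → R := fun j ↦
    if j = 0 then g a else ∑ A ∈ (M.erase a).powersetCard j, ∏ b ∈ A, g b
  refine ara_le (fun j : Fin (M.card - k) ↦ q j) ?_
  rw [hJ]
  apply le_antisymm
  · refine Ideal.radical_mono (Ideal.span_le.2 ?_)
    rintro _ ⟨j, rfl⟩
    have hg : ∀ b ∈ M, g b ∈ Ideal.span (g '' M) := fun b hb ↦
      Ideal.subset_span ⟨b, hb, rfl⟩
    by_cases hj : (j : ℕ) = 0
    · simpa [q, hj] using hg a ha
    · simp only [q, hj, if_false, SetLike.mem_coe]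
      refine Ideal.sum_mem _ fun A hA ↦ ?_
      obtain ⟨hAM, hAj⟩ := Finset.mem_powersetCard.1 hA
      obtain ⟨b, hb⟩ : A.Nonempty := Finset.card_pos.1 (by omega)
      exact Ideal.mem_of_dvd _ (Finset.dvd_prod_of_mem g hb)
        (hg b (Finset.mem_of_mem_erase (hAM hb)))
  · rw [Ideal.radical_le_radical_iff, Ideal.span_le, Ideal.radical_eq_sInf]
    rintro _ ⟨b, hb, rfl⟩
    refine Ideal.mem_sInf.2 ?_
    rintro p ⟨hqp, hp⟩
    have hq : ∀ j < M.card - k, q j ∈ p := fun j hj ↦ hqp (Ideal.subset_span ⟨⟨j, hj⟩, rfl⟩)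
    by_contra hbp
    have hM : (M.erase a).card + 1 = M.card := Finset.card_erase_add_one ha
    have hga : g a ∈ p := by simpa [q] using hq 0 (by omega)
    obtain ⟨N, hNM, hkN, hN⟩ := hk p hp hga
    let A := (M.erase a).filter fun c ↦ g c ∉ p
    have hbA : b ∈ A := by
      refine Finset.mem_filter.2 ⟨Finset.mem_erase.2 ⟨?_, hb⟩, hbp⟩
      rintro rfl
      exact hbp hga
    have hA0 : A.card ≠ 0 := Finset.card_ne_zero_of_mem hbA
    have hAN : A ⊆ M.erase a \ N := fun c hc ↦ by
      obtain ⟨h1, h2⟩ := Finset.mem_filter.1 hc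
      exact Finset.mem_sdiff.2 ⟨h1, fun h ↦ h2 (hN c h)⟩
    have hcard := Finset.card_le_card hAN
    rw [Finset.card_sdiff_of_subset hNM] at hcard
    have hqA := hq A.card (by omega)
    simp only [q, hA0, if_false] at hqA
    have hAmem : A ∈ (M.erase a).powersetCard A.card :=
      Finset.mem_powersetCard.2 ⟨Finset.filter_subset _ _, rfl⟩
    rw [← Finset.add_sum_erase _ _ hAmem] at hqA
    have hrest : ∑ B ∈ ((M.erase a).powersetCard A.card).erase A, ∏ c ∈ B, g c ∈ p := by
      refine Ideal.sum_mem _ fun B hB ↦ ?_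
      obtain ⟨hBA, hB⟩ := Finset.mem_erase.1 hB
      obtain ⟨hBM, hBc⟩ := Finset.mem_powersetCard.1 hB
      obtain ⟨c, hcB, hcA⟩ : ∃ c ∈ B, c ∉ A := by
        by_contra! h
        exact hBA (Finset.eq_of_subset_of_card_le h hBc.ge)
      refine Ideal.mem_of_dvd _ (Finset.dvd_prod_of_mem g hcB) ?_
      by_contra hc
      exact hcA (Finset.mem_filter.2 ⟨hBM hcB, hc⟩)
    obtain ⟨c, hc, hcp⟩ := Ideal.IsPrime.prod_mem_iff.1 ((p.add_mem_iff_left hrest).1 hqA)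
    exact (Finset.mem_filter.1 hc).2 hcp

theorem X_mem_span_X_image {K σ : Type*} [Field K] {s : Set σ} {i : σ} :
    (X i : MvPolynomial σ K) ∈ Ideal.span ((fun j ↦ (X j : MvPolynomial σ K)) '' s) ↔ i ∈ s := by
  classical
  refine ⟨fun h ↦ ?_, fun h ↦ Ideal.subset_span ⟨i, h, rfl⟩⟩
  obtain ⟨j, hj, hij⟩ := mem_ideal_span_X_image.1 h (Finsupp.single i 1) (by simp [support_X])
  obtain rfl : i = j := by
    by_contra hne
    simp [hne] at hij
  exact hj

/-- Every vertex cover `T` of the generators of a squarefree monomial ideal contains the variables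
generating some minimal prime of that ideal. -/
theorem exists_minimalPrime_subset_of_cover {K σ : Type*} [Field K]
    {M : Set (Finset σ)} {T : Set σ} (hT : ∀ S ∈ M, ∃ i ∈ S, i ∈ T) :
    ∃ p ∈ (Ideal.span ((fun S ↦ ∏ i ∈ S, (X i : MvPolynomial σ K)) '' M)).minimalPrimes,
      ∀ i, X i ∈ p → i ∈ T := by
  classical
  let φ : MvPolynomial σ K →ₐ[K] MvPolynomial σ K := aeval fun i ↦ if i ∈ T then 0 else X i
  have hφ : ∀ i, X i ∈ RingHom.ker φ ↔ i ∈ T := fun i ↦ by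
    by_cases h : i ∈ T <;> simp [RingHom.mem_ker, φ, h]
  have hprime : (RingHom.ker φ).IsPrime := RingHom.ker_isPrime _
  obtain ⟨p, hp, hpφ⟩ := Ideal.exists_minimalPrimes_le (J := RingHom.ker φ)
    (I := Ideal.span ((fun S ↦ ∏ i ∈ S, (X i : MvPolynomial σ K)) '' M)) (by
      rw [Ideal.span_le]
      rintro _ ⟨S, hS, rfl⟩
      obtain ⟨i, hiS, hiT⟩ := hT S hS
      exact Ideal.mem_of_dvd _ (Finset.dvd_prod_of_mem _ hiS) ((hφ i).2 hiT))
  exact ⟨p, hp, fun i hi ↦ (hφ i).1 (hpφ hi)⟩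

/-- If every minimal prime is generated by at most `t` variables and there are more than `k * t`
generators, then some generator involves only variables lying in more than `k` generators. -/
theorem exists_forall_lt_card_filter {K σ : Type*} [Field K] [DecidableEq σ]
    {M : Finset (Finset σ)} {k t : ℕ}
    (ht : ∀ p ∈ (Ideal.span ((fun S ↦ ∏ i ∈ S, (X i : MvPolynomial σ K)) ''
      (M : Set (Finset σ)))).minimalPrimes,
      ∃ S : Finset σ, S.card ≤ t ∧ p = Ideal.span ((fun i ↦ (X i : MvPolynomial σ K)) '' S))
    (hkt : k * t < M.card) :
    ∃ S ∈ M, ∀ i ∈ S, k < (M.filter (i ∈ ·)).card := by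
  by_contra! h
  obtain ⟨p, hp, hpT⟩ := exists_minimalPrime_subset_of_cover (K := K) (M := (M : Set (Finset σ)))
    (T := {i | (M.filter (i ∈ ·)).card ≤ k}) h
  obtain ⟨S, hS, rfl⟩ := ht p hp
  have hcover : M ⊆ S.biUnion fun i ↦ M.filter (i ∈ ·) := fun A hA ↦ by
    have hmem := hp.1.2 (Ideal.subset_span ⟨A, hA, rfl⟩)
    have := hp.1.1
    obtain ⟨i, hiA, hi⟩ := Ideal.IsPrime.prod_mem_iff.1 hmem
    exact Finset.mem_biUnion.2 ⟨i, X_mem_span_X_image.1 hi, Finset.mem_filter.2 ⟨hA, hiA⟩⟩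
  have h1 := (Finset.card_le_card hcover).trans
    (Finset.card_biUnion_le_card_mul _ _ k fun i hi ↦ hpT i (X_mem_span_X_image.2 hi))
  nlinarith

theorem ara_le_of_mu_le {K : Type*} [Field K] (n : ℕ)
    (M : Finset (Finset (Fin n))) (I J : Ideal (MvPolynomial (Fin n) K))
    -- the radical of `J` is the squarefree monomial ideal `I`
    (hJ : Ideal.radical J = I)
    -- `M` is the minimal generating set of squarefree monomials for `I`
    (hI : I = Ideal.span ((fun S => ∏ i ∈ S, X i) '' (M : Set (Finset (Fin n)))))
    (hmin : ∀ M' : Finset (Finset (Fin n)), M' ⊂ M →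
      Ideal.span ((fun S => ∏ i ∈ S, X i) '' (M' : Set (Finset (Fin n)))) ≠ I)
    -- `I` is generated by at most `n - 1` squarefree monomials
    (hcard : M.card ≤ n - 1)
    -- the minimal primes of `I` are exactly the ideals generated by the sets of
    -- variables listed in `primes`; the height of such a prime is the number of variables
    (primes : Finset (Finset (Fin n))) (hne : primes.Nonempty)
    (hprimes : ∀ p : Ideal (MvPolynomial (Fin n) K), p ∈ I.minimalPrimes ↔
      ∃ S ∈ primes, p = Ideal.span ((fun i => (X i : MvPolynomial (Fin n) K)) '' S)) :
    (ara J : ℝ) ≤ (n : ℝ) - ((n : ℝ) - 1) / (primes.sup' hne (fun S => S.card) : ℝ) := by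
  classical
  obtain ⟨t, ht⟩ : ∃ t, t = primes.sup' hne (fun S => S.card) := ⟨_, rfl⟩
  have hsup : (primes.sup' hne (fun S => S.card) : ℝ) = t := by
    rw [ht]
    exact (Nat.cast_finsetSup' _ hne).symm
  rw [hsup]
  have hrad : J.radical = (Ideal.span ((fun S ↦ ∏ i ∈ S, (X i : MvPolynomial (Fin n) K)) ''
      (M : Set (Finset (Fin n))))).radical := by
    rw [← hI, ← hJ, Ideal.radical_idem]
  obtain rfl | hM := M.eq_empty_or_nonempty
  · have h0 : ara J ≤ 0 := ara_le (fun j ↦ j.elim0) (by rw [hrad]; simp)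
    have h0' : (ara J : ℝ) = 0 := by exact_mod_cast Nat.le_zero.1 h0
    rw [h0', sub_nonneg]
    rcases Nat.eq_zero_or_pos t with h | h
    · simp [h]
    · have : (1 : ℝ) ≤ t := by exact_mod_cast h
      rw [div_le_iff₀ (by linarith)]
      nlinarith [(Nat.cast_nonneg n : (0 : ℝ) ≤ n)]
  have hm : 0 < M.card := hM.card_pos
  obtain ⟨k, hk⟩ : ∃ k, k = (M.card - 1) / t := ⟨_, rfl⟩
  have hkt : k * t < M.card := by
    have := Nat.div_mul_le_self (M.card - 1) t
    rw [← hk] at this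
    omega
  have hkM : k < M.card := hk ▸ (Nat.div_le_self _ _).trans_lt (Nat.sub_lt hm one_pos)
  obtain ⟨a, ha, hak⟩ := exists_forall_lt_card_filter (K := K) (M := M) (t := t) (by
    intro p hp
    rw [← hI] at hp
    obtain ⟨S, hS, h⟩ := (hprimes p).1 hp
    exact ⟨S, ht ▸ Finset.le_sup' (fun S : Finset (Fin n) => S.card) hS, h⟩) hkt
  have hara : ara J ≤ M.card - k := by
    refine ara_le_card_sub hrad ha hkM fun p hp hap ↦ ?_
    obtain ⟨i, hia, hi⟩ := Ideal.IsPrime.prod_mem_iff.1 hap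
    refine ⟨(M.filter (i ∈ ·)).erase a, Finset.erase_subset_erase _ (Finset.filter_subset _ _),
      ?_, fun b hb ↦ ?_⟩
    · have := hak i hia
      have := Finset.pred_card_le_card_erase (s := M.filter (i ∈ ·)) (a := a)
      omega
    · exact Ideal.mem_of_dvd _
        (Finset.dvd_prod_of_mem _ (Finset.mem_filter.1 (Finset.mem_of_mem_erase hb)).2) hi
  have hara' : (ara J : ℝ) + k ≤ M.card := by
    exact_mod_cast (by omega : ara J + k ≤ M.card)
  have hmn : (M.card : ℝ) + 1 ≤ n := by exact_mod_cast (by omega : M.card + 1 ≤ n)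
  rcases Nat.eq_zero_or_pos t with h | h
  · simp only [h, Nat.cast_zero, div_zero, sub_zero]
    linarith [(Nat.cast_nonneg k : (0 : ℝ) ≤ k)]
  · have h1 : (1 : ℝ) ≤ t := by exact_mod_cast h
    have hMt : (M.card : ℝ) ≤ k * t + t := by
      have := Nat.lt_div_mul_add (a := M.card - 1) h
      rw [← hk] at this
      exact_mod_cast (by omega : M.card ≤ k * t + t)
    rw [le_sub_comm, div_le_iff₀ (by linarith)]
    nlinarith
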